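/- Concatenation with a left inverse of the incidence matrix. Let G be a connected graph with positive Schwinger parameters, 𝒞 a cycle incidence matrix of G, and R any real m × (n−1) matrix with Rᵀ 𝕀 = 1_{n−1}. Then det[𝒞|R] · det[𝒞|D⁻¹𝕀] = ψ_G · ∏_{i=1}^m a_i^{−1}. In particular det[𝒞|R] ∈ {+1, −1}, and det[𝒞|R] has the same value for every such R. -/

import Mathlib

open Matrix BigOperators

namespace GraphForms

/-- Vertices `x` and `y` are connected using only edges in `T` (in either direction). -/
def Conn (m n : ℕ) (s t : Fin m → Fin n) (T : Set (Fin m)) (x y : Fin n) : Prop :=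
  Relation.ReflTransGen
    (fun a b => ∃ e ∈ T, (s e = a ∧ t e = b) ∨ (s e = b ∧ t e = a)) x y

/-- The graph is connected. -/
def IsConnectedGraph (m n : ℕ) (s t : Fin m → Fin n) : Prop :=
  ∀ x y, Conn m n s t Set.univ x y

/-- `T ⊆ E` is a spanning tree: it has `n - 1` edges and connects all vertices. -/
def IsSpanningTree (m n : ℕ) (s t : Fin m → Fin n) (T : Finset (Fin m)) : Prop :=
  T.card = n - 1 ∧ ∀ x y, Conn m n s t ↑T x y

/-- The reduced vertex incidence matrix `𝕀` (the distinguished vertex is the last one). -/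
def inc (R : Type*) [Ring R] (m n' : ℕ) (s t : Fin m → Fin (n' + 1)) :
    Matrix (Fin m) (Fin n') R :=
  Matrix.of fun e j =>
    (if t e = Fin.castSucc j then (1 : R) else 0) -
      (if s e = Fin.castSucc j then (1 : R) else 0)

/-- `C` is a cycle incidence matrix: its columns lie in, and form a `ℤ`-basis of,
the lattice `{x : ℤ^E | 𝕀ᵀ x = 0}`. -/
def IsCycleMatrix (m n' ℓ : ℕ) (s t : Fin m → Fin (n' + 1))
    (C : Matrix (Fin m) (Fin ℓ) ℤ) : Prop :=
  (inc ℤ m n' s t)ᵀ * C = 0 ∧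
    ∀ x : Fin m → ℤ, (inc ℤ m n' s t)ᵀ.mulVec x = 0 →
      ∃! c : Fin ℓ → ℤ, C.mulVec c = x

/-- The concatenation `[X|Y]` of the columns of `X` and of `Y`, a square matrix. -/
def concat {R : Type*} {m ℓ c : ℕ} (h : ℓ + c = m) (X : Matrix (Fin m) (Fin ℓ) R)
    (Y : Matrix (Fin m) (Fin c) R) : Matrix (Fin m) (Fin m) R :=
  Matrix.of fun i j => Sum.elim (X i) (Y i) (finSumFinEquiv.symm (Fin.cast h.symm j))

/-- The row submatrix `X[S]` (rows of `S` taken in increasing order);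
junk value `0` if `S.card ≠ k`. -/
noncomputable def rowSub {R : Type*} [Zero R] {m c : ℕ} (X : Matrix (Fin m) (Fin c) R)
    (S : Finset (Fin m)) (k : ℕ) : Matrix (Fin k) (Fin c) R :=
  if h : S.card = k then Matrix.of fun i j => X ((S.orderIsoOfFin h) i : Fin m) j else 0

/-- The expanded vertex Laplacian `𝕄`, rows/columns indexed by edges and then vertices. -/
def MM (m n' : ℕ) (s t : Fin m → Fin (n' + 1)) (a : Fin m → ℝ) :
    Matrix (Fin (m + n')) (Fin (m + n')) ℝ :=
  Matrix.of fun i j =>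
    Matrix.fromBlocks (Matrix.diagonal a) (inc ℝ m n' s t) (-(inc ℝ m n' s t)ᵀ) 0
      (finSumFinEquiv.symm i) (finSumFinEquiv.symm j)

/-- The Symanzik polynomial `ψ_G = det 𝕄`. -/
noncomputable def psi (m n' : ℕ) (s t : Fin m → Fin (n' + 1)) (a : Fin m → ℝ) : ℝ :=
  (MM m n' s t a).det

/-- The Dodgson polynomial `ψ^{A,B}`: delete the rows in `A` and the columns in `B`
from `𝕄` (keeping the induced order) and take the determinant. -/
noncomputable def dodgson (m n' : ℕ) (s t : Fin m → Fin (n' + 1)) (a : Fin m → ℝ)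
    (A B : Finset (Fin (m + n'))) : ℝ :=
  if h : A.card = B.card then
    Matrix.det (Matrix.of fun i j : Fin (m + n' - A.card) =>
      MM m n' s t a
        ((Aᶜ.orderIsoOfFin (by simp [Finset.card_compl]) i : Fin (m + n')))
        ((Bᶜ.orderIsoOfFin (by simp [Finset.card_compl, h]) j : Fin (m + n'))))
  else 0

/-- Index of the edge `i` among the rows/columns of `𝕄`. -/
def edgeIdx (m n' : ℕ) (i : Fin m) : Fin (m + n') := Fin.castAdd n' i

/-- Index of the vertex `j` among the rows/columns of `𝕄`. -/
def vtxIdx (m n' : ℕ) (j : Fin n') : Fin (m + n') := Fin.natAdd m j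

/-- The edge Dodgson polynomial `ψ^{e_i,e_j}`. -/
noncomputable def dodgE (m n' : ℕ) (s t : Fin m → Fin (n' + 1)) (a : Fin m → ℝ)
    (i j : Fin m) : ℝ :=
  dodgson m n' s t a {edgeIdx m n' i} {edgeIdx m n' j}

/-- The vertex Dodgson polynomial `ψ^{v_i,v_j}`. -/
noncomputable def dodgV (m n' : ℕ) (s t : Fin m → Fin (n' + 1)) (a : Fin m → ℝ)
    (i j : Fin n') : ℝ :=
  dodgson m n' s t a {vtxIdx m n' i} {vtxIdx m n' j}

/-- The vertex Laplacian `L = 𝕀ᵀ D⁻¹ 𝕀`. -/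
noncomputable def vertexLap (m n' : ℕ) (s t : Fin m → Fin (n' + 1)) (a : Fin m → ℝ) :
    Matrix (Fin n') (Fin n') ℝ :=
  (inc ℝ m n' s t)ᵀ * Matrix.diagonal (fun i => (a i)⁻¹) * inc ℝ m n' s t

/-- The cycle Laplacian `Λ = 𝒞ᵀ D 𝒞`. -/
def cycleLap {m ℓ : ℕ} (a : Fin m → ℝ) (C : Matrix (Fin m) (Fin ℓ) ℤ) :
    Matrix (Fin ℓ) (Fin ℓ) ℝ :=
  (C.map (Int.cast : ℤ → ℝ))ᵀ * Matrix.diagonal a * C.map (Int.cast : ℤ → ℝ)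

/-- The degree-one generators `θ_i` of the exterior algebra `Ω`. -/
noncomputable def θ (m : ℕ) (i : Fin m) : ExteriorAlgebra ℝ (Fin m → ℝ) :=
  ExteriorAlgebra.ι ℝ (Pi.single i 1)

/-- The Pfaffian of a `2k × 2k` matrix with entries in the exterior algebra. -/
noncomputable def pfaffian {m N k : ℕ} (hk : N = 2 * k)
    (X : Matrix (Fin N) (Fin N) (ExteriorAlgebra ℝ (Fin m → ℝ))) :
    ExteriorAlgebra ℝ (Fin m → ℝ) :=
  ((2 ^ k * (Nat.factorial k : ℝ))⁻¹) •
    ∑ σ : Equiv.Perm (Fin N), (((Equiv.Perm.sign σ : ℤ) : ℝ)) •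
      (List.ofFn fun i : Fin k =>
        X (σ (Fin.cast hk.symm ⟨2 * i.1, by have := i.2; omega⟩))
          (σ (Fin.cast hk.symm ⟨2 * i.1 + 1, by have := i.2; omega⟩))).prod

/-- `dΛ = 𝒞ᵀ Θ 𝒞`, with `Θ = diag(θ_1, ..., θ_m)`, in the exterior algebra. -/
noncomputable def dLam {m ℓ : ℕ} (C : Matrix (Fin m) (Fin ℓ) ℤ) :
    Matrix (Fin ℓ) (Fin ℓ) (ExteriorAlgebra ℝ (Fin m → ℝ)) :=
  (C.map fun z => algebraMap ℝ (ExteriorAlgebra ℝ (Fin m → ℝ)) (z : ℝ))ᵀ *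
    Matrix.diagonal (θ m) *
    C.map fun z => algebraMap ℝ (ExteriorAlgebra ℝ (Fin m → ℝ)) (z : ℝ)

/-- The Pfaffian form `φ_G = (−2π)^{−ℓ/2} Pf(dΛ Λ⁻¹ dΛ) / √ψ_G`. -/
noncomputable def phiForm (m n' ℓ k : ℕ) (hk : ℓ = 2 * k)
    (s t : Fin m → Fin (n' + 1)) (a : Fin m → ℝ) (C : Matrix (Fin m) (Fin ℓ) ℤ) :
    ExteriorAlgebra ℝ (Fin m → ℝ) :=
  ((((-2) * Real.pi) ^ k)⁻¹ * (Real.sqrt (psi m n' s t a))⁻¹) •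
    pfaffian hk
      (dLam C * ((cycleLap a C)⁻¹).map (algebraMap ℝ (ExteriorAlgebra ℝ (Fin m → ℝ))) *
        dLam C)

open Classical in
/-- Sum of `F T` over all spanning trees `T` of the graph. -/
noncomputable def treeSum {β : Type*} [AddCommMonoid β] (m n' : ℕ)
    (s t : Fin m → Fin (n' + 1)) (F : Finset (Fin m) → β) : β :=
  ∑ T ∈ Finset.univ.filter (fun T : Finset (Fin m) => IsSpanningTree m (n' + 1) s t T), F T

open Classical in
/-- The number of spanning trees of the graph. -/
noncomputable def treeCount (m n' : ℕ) (s t : Fin m → Fin (n' + 1)) : ℕ :=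
  (Finset.univ.filter (fun T : Finset (Fin m) => IsSpanningTree m (n' + 1) s t T)).card

/-- The summand of `α_G` corresponding to a spanning tree `T`. -/
noncomputable def alphaTerm {m n' ℓ k : ℕ} (hk : ℓ = 2 * k)
    (s t : Fin m → Fin (n' + 1)) (a : Fin m → ℝ) (T : Finset (Fin m)) :
    ExteriorAlgebra ℝ (Fin m → ℝ) :=
  if h : Tᶜ.card = ℓ then
    ((rowSub (inc ℝ m n' s t) T n').det *
        ∑ σ : Equiv.Perm (Fin ℓ), ∏ i : Fin k,
          dodgE m n' s t a
            ((Tᶜ.orderIsoOfFin h) (σ (Fin.cast hk.symm ⟨2 * i.1, by have := i.2; omega⟩)) : Fin m)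
            ((Tᶜ.orderIsoOfFin h) (σ (Fin.cast hk.symm ⟨2 * i.1 + 1, by have := i.2; omega⟩)) : Fin m)) •
      (List.ofFn fun j : Fin ℓ => θ m ((Tᶜ.orderIsoOfFin h) j : Fin m)).prod
  else 0

/-- The topological form `α_G`. -/
noncomputable def alphaForm (m n' ℓ k : ℕ) (hk : ℓ = 2 * k)
    (s t : Fin m → Fin (n' + 1)) (a : Fin m → ℝ) :
    ExteriorAlgebra ℝ (Fin m → ℝ) :=
  ((Real.pi ^ k * 4 ^ ℓ * (Nat.factorial k : ℝ) *
      psi m n' s t a ^ (((ℓ : ℝ) + 1) / 2))⁻¹) •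
    treeSum m n' s t (alphaTerm hk s t a)

/-- A walk in the graph, with signed edge traversals. -/
structure GWalk (m n : ℕ) (s t : Fin m → Fin n) (k : ℕ) where
  g : Fin k → Fin m
  ε : Fin k → ℤ
  u : Fin (k + 1) → Fin n
  hε : ∀ i, ε i = 1 ∨ ε i = -1
  hstep : ∀ i : Fin k,
    (ε i = 1 → s (g i) = u i.castSucc ∧ t (g i) = u i.succ) ∧
    (ε i = -1 → s (g i) = u i.succ ∧ t (g i) = u i.castSucc)

/-- The signed incidence vector of a walk. -/
def GWalk.vec {m n k : ℕ} {s t : Fin m → Fin n} (W : GWalk m n s t k) : Fin m → ℤ :=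
  fun e => ∑ i : Fin k, if W.g i = e then W.ε i else 0

/-- The lift of a vector along the subdivision of the edge `k` into two edges. -/
def liftVec {m : ℕ} (k : Fin m) (x : Fin m → ℤ) : Fin (m + 1) → ℤ :=
  fun i => if _ : i.1 ≤ k.1 then x ⟨i.1, by have := k.2; omega⟩
    else x ⟨i.1 - 1, by have := i.2; omega⟩

/-- The concatenation `[X|Y]` is `Matrix.fromCols X Y` up to reindexing the columns. -/
lemma concat_eq_submatrix {R : Type*} {m ℓ c : ℕ} (h : ℓ + c = m) (X : Matrix (Fin m) (Fin ℓ) R)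
    (Y : Matrix (Fin m) (Fin c) R) :
    concat h X Y =
      (Matrix.fromCols X Y).submatrix id ((finCongr h.symm).trans finSumFinEquiv.symm) := by
  ext i j
  simp only [concat, Matrix.of_apply, Matrix.submatrix_apply, id, Equiv.trans_apply,
    finCongr_apply]
  cases finSumFinEquiv.symm (Fin.cast h.symm j) <;> rfl

/-- If `X Q + Y₀ J = 1`, then `det [X|Y] = det [X|Y₀] * det (J Y)` for every `Y`. -/
lemma det_concat_eq_mul {R : Type*} [CommRing R] {m ℓ c : ℕ} (h : ℓ + c = m)
    {X : Matrix (Fin m) (Fin ℓ) R} {Y₀ : Matrix (Fin m) (Fin c) R}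
    {Q : Matrix (Fin ℓ) (Fin m) R} {J : Matrix (Fin c) (Fin m) R}
    (hQ : X * Q + Y₀ * J = 1) (Y : Matrix (Fin m) (Fin c) R) :
    (concat h X Y).det = (concat h X Y₀).det * (J * Y).det := by
  have key : Matrix.fromCols X Y =
      Matrix.fromCols X Y₀ * Matrix.fromBlocks 1 (Q * Y) 0 (J * Y) := by
    have hY : X * (Q * Y) + Y₀ * (J * Y) = Y := by
      rw [← Matrix.mul_assoc, ← Matrix.mul_assoc, ← Matrix.add_mul, hQ, Matrix.one_mul]
    rw [Matrix.fromCols_mul_fromBlocks, hY]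
    simp
  set e := (finCongr h.symm).trans finSumFinEquiv.symm with he
  have hmul : concat h X Y =
      concat h X Y₀ * (Matrix.fromBlocks 1 (Q * Y) 0 (J * Y)).submatrix e e := by
    rw [concat_eq_submatrix, concat_eq_submatrix, ← he, key,
      Matrix.submatrix_mul_equiv _ _ id e e]
  rw [hmul, Matrix.det_mul, Matrix.det_submatrix_equiv_self, Matrix.det_fromBlocks_zero₂₁,
    Matrix.det_one, one_mul]

/-- If `X Q + Y J = 1`, then the determinant of `[X|Y]` is a unit. -/
lemma isUnit_det_concat {R : Type*} [CommRing R] {m ℓ c : ℕ} (h : ℓ + c = m)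
    {X : Matrix (Fin m) (Fin ℓ) R} {Y : Matrix (Fin m) (Fin c) R}
    {Q : Matrix (Fin ℓ) (Fin m) R} {J : Matrix (Fin c) (Fin m) R}
    (hQ : X * Q + Y * J = 1) : IsUnit (concat h X Y).det := by
  refine Matrix.isUnit_det_of_right_inverse
    (B := (Matrix.fromRows Q J).submatrix ((finCongr h.symm).trans finSumFinEquiv.symm) id) ?_
  rw [concat_eq_submatrix, Matrix.submatrix_mul_equiv, Matrix.fromCols_mul_fromRows, hQ]
  simp

/-- Concatenation commutes with entrywise ring homomorphisms. -/
lemma concat_map {R S : Type*} {m ℓ c : ℕ} (h : ℓ + c = m) (f : R → S)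
    (X : Matrix (Fin m) (Fin ℓ) R) (Y : Matrix (Fin m) (Fin c) R) :
    concat h (X.map f) (Y.map f) = (concat h X Y).map f := by
  ext i j
  simp only [concat, Matrix.of_apply, Matrix.map_apply]
  cases finSumFinEquiv.symm (Fin.cast h.symm j) <;> rfl

lemma inc_map_intCast (R : Type*) [Ring R] (m n' : ℕ) (s t : Fin m → Fin (n' + 1)) :
    (inc ℤ m n' s t).map (Int.cast : ℤ → R) = inc R m n' s t := by
  ext i j
  simp [inc]

/-- Two connected vertices are joined by an integral chain of edges whose boundary is the
difference of the endpoints. -/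
lemma Conn.exists_chain {m n' : ℕ} {s t : Fin m → Fin (n' + 1)} {T : Set (Fin m)}
    {x y : Fin (n' + 1)} (h : Conn m (n' + 1) s t T x y) :
    ∃ p : Fin m → ℤ, (inc ℤ m n' s t)ᵀ.mulVec p = fun j =>
      (if y = Fin.castSucc j then 1 else 0) - (if x = Fin.castSucc j then 1 else 0) := by
  induction h with
  | refl => exact ⟨0, by ext j; simp⟩
  | tail _ hstep ih =>
    obtain ⟨p, hp⟩ := ih
    obtain ⟨e, -, ⟨rfl, rfl⟩ | ⟨rfl, rfl⟩⟩ := hstep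
    · refine ⟨p + Pi.single e 1, ?_⟩
      rw [Matrix.mulVec_add, hp]
      ext j
      simp [inc]
    · refine ⟨p - Pi.single e 1, ?_⟩
      rw [Matrix.mulVec_sub, hp]
      ext j
      simp [inc]

/-- The transposed reduced incidence matrix of a connected graph has an integral right inverse. -/
lemma IsConnectedGraph.exists_right_inverse {m n' : ℕ} {s t : Fin m → Fin (n' + 1)}
    (h : IsConnectedGraph m (n' + 1) s t) :
    ∃ Y : Matrix (Fin m) (Fin n') ℤ, (inc ℤ m n' s t)ᵀ * Y = 1 := by
  choose p hp using fun v : Fin n' => (h (Fin.last n') v.castSucc).exists_chain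
  refine ⟨Matrix.of fun e v => p v e, ?_⟩
  ext j v
  have hj := congrFun (hp v) j
  rw [if_neg (Fin.castSucc_lt_last j).ne', sub_zero] at hj
  refine hj.trans ?_
  simp [Matrix.one_apply, eq_comm]

/-- A cycle matrix and a right inverse of `𝕀ᵀ` split the lattice of integral edge vectors. -/
lemma IsCycleMatrix.exists_splitting {m n' ℓ : ℕ} {s t : Fin m → Fin (n' + 1)}
    {C : Matrix (Fin m) (Fin ℓ) ℤ} (hC : IsCycleMatrix m n' ℓ s t C)
    {Y : Matrix (Fin m) (Fin n') ℤ} (hY : (inc ℤ m n' s t)ᵀ * Y = 1) :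
    ∃ Q : Matrix (Fin ℓ) (Fin m) ℤ, C * Q + Y * (inc ℤ m n' s t)ᵀ = 1 := by
  set J := (inc ℤ m n' s t)ᵀ
  have hker : J * (1 - Y * J) = 0 := by
    rw [Matrix.mul_sub, ← Matrix.mul_assoc, hY, Matrix.mul_one, Matrix.one_mul, sub_self]
  have hcol (i : Fin m) : ∃ q : Fin ℓ → ℤ, C.mulVec q = (1 - Y * J).col i :=
    (hC.2 _ (funext fun j => congrFun (congrFun hker j) i)).exists
  choose q hq using hcol
  refine ⟨Matrix.of fun k i => q i k, eq_sub_iff_add_eq.mp ?_⟩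
  ext i j
  exact congrFun (hq j) i

/-- The Symanzik polynomial as the determinant of the vertex Laplacian. -/
lemma psi_eq_prod_mul_det_vertexLap {m n' : ℕ} (s t : Fin m → Fin (n' + 1)) {a : Fin m → ℝ}
    (ha : ∀ i, a i ≠ 0) :
    psi m n' s t a = (∏ i, a i) * (vertexLap m n' s t a).det := by
  have hMM : MM m n' s t a =
      (Matrix.fromBlocks (Matrix.diagonal a) (inc ℝ m n' s t) (-(inc ℝ m n' s t)ᵀ) 0).submatrix
        finSumFinEquiv.symm finSumFinEquiv.symm := rfl
  have hinv : Matrix.diagonal (fun i => (a i)⁻¹) * Matrix.diagonal a = 1 := by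
    simp [ha]
  let _ : Invertible (Matrix.diagonal a) := invertibleOfLeftInverse _ _ hinv
  rw [psi, hMM, Matrix.det_submatrix_equiv_self, Matrix.det_fromBlocks₁₁, Matrix.det_diagonal,
    Matrix.invOf_eq_nonsing_inv, Matrix.inv_eq_left_inv hinv, vertexLap]
  simp

/-- **Concatenation with a left inverse of the incidence matrix.** -/
theorem det_concat_left_inverse_incidence (m n' ℓ : ℕ) (s t : Fin m → Fin (n' + 1))
    (hconn : IsConnectedGraph m (n' + 1) s t) (hm : ℓ + n' = m)
    (a : Fin m → ℝ) (ha : ∀ i, 0 < a i)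
    (C : Matrix (Fin m) (Fin ℓ) ℤ) (hC : IsCycleMatrix m n' ℓ s t C)
    (R : Matrix (Fin m) (Fin n') ℝ) (hR : Rᵀ * inc ℝ m n' s t = 1) :
    (concat hm (C.map (Int.cast : ℤ → ℝ)) R).det *
        (concat hm (C.map (Int.cast : ℤ → ℝ))
          (Matrix.diagonal (fun i => (a i)⁻¹) * inc ℝ m n' s t)).det =
      psi m n' s t a * ∏ i, (a i)⁻¹ ∧
    ((concat hm (C.map (Int.cast : ℤ → ℝ)) R).det = 1 ∨
      (concat hm (C.map (Int.cast : ℤ → ℝ)) R).det = -1) ∧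
    ∀ R' : Matrix (Fin m) (Fin n') ℝ, R'ᵀ * inc ℝ m n' s t = 1 →
      (concat hm (C.map (Int.cast : ℤ → ℝ)) R').det =
        (concat hm (C.map (Int.cast : ℤ → ℝ)) R).det := by
  obtain ⟨Y, hY⟩ := hconn.exists_right_inverse
  obtain ⟨Q, hQ⟩ := hC.exists_splitting hY
  set cast : ℤ → ℝ := Int.cast
  have hQ' : C.map cast * Q.map cast + Y.map cast * (inc ℝ m n' s t)ᵀ = 1 := by
    have h := congrArg (Int.castRingHom ℝ).mapMatrix hQ
    rw [map_add, map_one, RingHom.mapMatrix_apply, RingHom.mapMatrix_apply, Matrix.map_mul,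
      Matrix.map_mul, Matrix.transpose_map] at h
    rwa [Int.coe_castRingHom, inc_map_intCast] at h
  have hdet := det_concat_eq_mul hm hQ'
  have hunit : (concat hm (C.map cast) (Y.map cast)).det = 1 ∨
      (concat hm (C.map cast) (Y.map cast)).det = -1 := by
    have hcast : (concat hm (C.map cast) (Y.map cast)).det = ((concat hm C Y).det : ℝ) := by
      rw [concat_map]
      exact ((Int.castRingHom ℝ).map_det _).symm
    rw [hcast]
    exact (Int.isUnit_iff.mp (isUnit_det_concat hm hQ)).imp (fun h => by simp [h])
      (fun h => by simp [h])
  have hleft (S : Matrix (Fin m) (Fin n') ℝ) (hS : Sᵀ * inc ℝ m n' s t = 1) :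
      (concat hm (C.map cast) S).det = (concat hm (C.map cast) (Y.map cast)).det := by
    have hS' : (inc ℝ m n' s t)ᵀ * S = 1 := by
      simpa using congrArg Matrix.transpose hS
    rw [hdet, hS', Matrix.det_one, mul_one]
  refine ⟨?_, ?_, fun R' hR' => (hleft R' hR').trans (hleft R hR).symm⟩
  · have hprod : (∏ i, a i) * ∏ i, (a i)⁻¹ = 1 := by
      rw [← Finset.prod_mul_distrib]
      exact Finset.prod_eq_one fun i _ => mul_inv_cancel₀ (ha i).ne'
    have hsq : (concat hm (C.map cast) (Y.map cast)).det *
        (concat hm (C.map cast) (Y.map cast)).det = 1 := by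
      rcases hunit with h | h <;> simp [h]
    rw [hleft R hR, hdet (_ * _), ← Matrix.mul_assoc, ← vertexLap, ← mul_assoc, hsq,
      psi_eq_prod_mul_det_vertexLap s t fun i => (ha i).ne', mul_right_comm, hprod]
  · rw [hleft R hR]
    exact hunit

end GraphForms
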